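/- Fix K ≥ 1, r̂0 > 0, α > 0, ω > 0, n ∈ {0,…,K}, and set u(k) = (r̂0+1)^{k−1} r̂0 and ℙ = ℙ_n(α) = C(K,n)(1−e^{−α})^n e^{−α(K−n)} > 0. Suppose ζ_1, …, ζ_K and λ_{n+1}, …, λ_K satisfy: ζ_k = √(ω u(k)(1−e^{−α})) for 1 ≤ k ≤ n; for n+1 ≤ k ≤ K, 0 ≤ λ_k < ℙ, ζ_k = √( ℙ ω u(k) / (ℙ − λ_k) ), ζ_k ≥ α, and λ_k (ζ_k − α) = 0. Then ζ_k ≤ ζ_{k+1} for every k ∈ {1, …, K−1}. In particular, the KKT solution of the relaxed problem (P5) automatically satisfies the monotonicity constraint of problem (P4), so problems (P4) and (P5) are equivalent. -/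

import Mathlib

open Real Finset

/-- (Proposition 5.) The KKT solution of the relaxed problem (P5) —
`ζ k = √(ω u(k)(1-e^{-α}))` for `k ≤ n`, and for `k > n`, `0 ≤ λ k < ℙ_n(α)`,
`ζ k = √(ℙ ω u(k)/(ℙ - λ k))`, `ζ k ≥ α` with complementary slackness
`λ k (ζ k - α) = 0` — is automatically nondecreasing, `ζ k ≤ ζ (k+1)` for
`1 ≤ k ≤ K-1`; hence problems (P4) and (P5) are equivalent. -/
theorem stmt17 (K : ℕ) (hK : 1 ≤ K) (rhat : ℝ) (hr : 0 < rhat) (α : ℝ) (hα : 0 < α)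
    (ω : ℝ) (hω : 0 < ω) (n : ℕ) (hn : n ≤ K)
    (u : ℕ → ℝ) (hu : ∀ k, u k = (rhat + 1) ^ (k - 1) * rhat)
    (Pn : ℝ)
    (hPn : Pn = (K.choose n : ℝ) * (1 - Real.exp (-α)) ^ n * Real.exp (-α * ((K : ℝ) - n)))
    (ζ lam : ℕ → ℝ)
    (hζ1 : ∀ k, 1 ≤ k → k ≤ n → ζ k = Real.sqrt (ω * (u k * (1 - Real.exp (-α)))))
    (hlam : ∀ k, n < k → k ≤ K → 0 ≤ lam k ∧ lam k < Pn)
    (hζ2 : ∀ k, n < k → k ≤ K → ζ k = Real.sqrt (Pn * ω * u k / (Pn - lam k)))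
    (hζα : ∀ k, n < k → k ≤ K → α ≤ ζ k)
    (hcs : ∀ k, n < k → k ≤ K → lam k * (ζ k - α) = 0) :
    ∀ k, 1 ≤ k → k ≤ K - 1 → ζ k ≤ ζ (k + 1) := by
  have hu0 : ∀ k, 0 ≤ u k := fun k => by rw [hu]; positivity
  have hu_mono : ∀ k, u k ≤ u (k + 1) := fun k => by
    rw [hu, hu]
    gcongr
    · linarith
    · omega
  have hlow : ∀ k, n < k → k ≤ K → √(ω * u k) ≤ ζ k := fun k h1 h2 => by
    obtain ⟨h3, h4⟩ := hlam k h1 h2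
    rw [hζ2 k h1 h2]
    apply Real.sqrt_le_sqrt
    rw [le_div_iff₀ (by linarith)]
    nlinarith [mul_nonneg (mul_nonneg hω.le (hu0 k)) h3]
  have he0 : 0 ≤ 1 - Real.exp (-α) := by
    linarith [Real.exp_le_one_iff.mpr (by linarith : -α ≤ 0)]
  have he1 : 1 - Real.exp (-α) ≤ 1 := by linarith [Real.exp_pos (-α)]
  intro k hk1 hkK
  have hk : k + 1 ≤ K := by omega
  rcases le_or_gt (k + 1) n with h | h
  · rw [hζ1 k hk1 (by omega), hζ1 (k + 1) (by omega) h]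
    gcongr
    exact hu_mono k
  rcases le_or_gt k n with h' | h'
  · refine le_trans ?_ (hlow (k + 1) h hk)
    rw [hζ1 k hk1 h']
    gcongr
    exact (mul_le_of_le_one_right (hu0 k) he1).trans (hu_mono k)
  · rcases mul_eq_zero.mp (hcs k h' (by omega)) with h0 | h0
    · refine le_trans ?_ (hlow (k + 1) h hk)
      have hP : Pn ≠ 0 := by
        obtain ⟨h1, h2⟩ := hlam k h' (by omega)
        exact (h1.trans_lt h2).ne'
      rw [hζ2 k h' (by omega), h0, sub_zero, mul_assoc, mul_div_cancel_left₀ _ hP]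
      gcongr
      exact hu_mono k
    · linarith [hζα (k + 1) h hk]
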